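/- arXiv:1801.03931 — 2 statements merged into one kernel-verified Lean document; each statement's English description precedes it below -/
import Mathlib

section
/- (Appendix, inequality (27)) Let d ≥ 2, n = d+1, and fix nonnegative integers ℓ₁, ℓ₂ with ℓ := ℓ₁+ℓ₂ < d and ℓ₁ ≤ ℓ₂. For any symmetrical code that satisfies node regeneration, and for any m ∈ [1:ℓ₁] and k ∈ [ℓ+1:d], one has H(S_{ℓ₁+1→[1:m]}) + H(U^{(ℓ₁,ℓ)}, S_{[ℓ+2:k]→ℓ+1}) ≥ H(S_{ℓ₁+1→[1:m−1]}) + H(U^{(ℓ₁,ℓ)}, S_{[ℓ+2:k+1]→ℓ+1}). -/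
open scoped BigOperators Classical

namespace MDCSR

noncomputable section

/-- `X` is a deterministic function of `Y`. -/
def IsFuncOf {Ω α β : Type*} (X : Ω → α) (Y : Ω → β) : Prop :=
  ∃ f : β → α, ∀ ω, X ω = f (Y ω)

variable {Ω V : Type} [Fintype Ω]

/-- Probability of the event `X = x` under the probability mass function `p`. -/
def pm (p : Ω → ℝ) {α : Type*} (X : Ω → α) (x : α) : ℝ :=
  ∑ ω ∈ Finset.univ.filter (fun ω' => X ω' = x), p ω

/-- Shannon entropy of the random variable `X` under the probability mass function `p`. -/
def H (p : Ω → ℝ) {α : Type*} (X : Ω → α) : ℝ :=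
  -∑ ω, p ω * Real.log (pm p X (X ω))

/-- An `(n = d+1, d)` code: messages `M 1, …, M d`, a key `K`, node contents
`W 1, …, W (d+1)`, and repair data `S i j` (data downloaded from node `i` to repair
node `j`), all random variables on a common finite probability space `(Ω, p)`.
The messages are mutually independent, the key is independent of the messages,
each `W i` is a deterministic function of the messages and the key, and each
`S i j` is a deterministic function of `W i`. -/
structure Code (Ω V : Type) [Fintype Ω] (d : ℕ) : Type where
  p : Ω → ℝ
  p_nonneg : ∀ ω, 0 ≤ p ω
  p_sum : ∑ ω, p ω = 1
  M : ℕ → Ω → V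
  K : Ω → V
  W : ℕ → Ω → V
  S : ℕ → ℕ → Ω → V
  M_indep : ∀ x : ℕ → V,
    pm p (fun ω (i : Fin d) => M (↑i + 1) ω) (fun i => x (↑i + 1)) =
      ∏ i ∈ Finset.Icc 1 d, pm p (M i) (x i)
  K_indep : ∀ (k : V) (x : ℕ → V),
    pm p (fun ω => (K ω, fun (i : Fin d) => M (↑i + 1) ω)) (k, fun i => x (↑i + 1)) =
      pm p K k * pm p (fun ω (i : Fin d) => M (↑i + 1) ω) (fun i => x (↑i + 1))
  W_func : ∀ i ∈ Finset.Icc 1 (d + 1),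
    IsFuncOf (W i) (fun ω => ((fun (j : Fin d) => M (↑j + 1) ω), K ω))
  S_func : ∀ i ∈ Finset.Icc 1 (d + 1), ∀ j ∈ Finset.Icc 1 (d + 1), i ≠ j →
    IsFuncOf (S i j) (W i)

/-- Descriptors for the basic random variables of a code. -/
inductive Atom where
  | M : ℕ → Atom
  | K : Atom
  | W : ℕ → Atom
  | S : ℕ → ℕ → Atom

variable {d : ℕ}

/-- The random variable described by an atom. -/
def Code.atomRV (C : Code Ω V d) : Atom → Ω → V
  | .M i => C.M i
  | .K => C.K
  | .W i => C.W i
  | .S i j => C.S i j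

/-- The joint random variable (tuple) described by a list of atoms. -/
def Code.rv (C : Code Ω V d) (L : List Atom) : Ω → List V :=
  fun ω => L.map fun a => C.atomRV a ω

/-- Joint entropy of a tuple of basic random variables. -/
def Code.HL (C : Code Ω V d) (L : List Atom) : ℝ := H C.p (C.rv L)

/-- Conditional entropy `H(L₁ | L₂)`. -/
def Code.CH (C : Code Ω V d) (L₁ L₂ : List Atom) : ℝ := C.HL (L₁ ++ L₂) - C.HL L₂

/-- Mutual information `I(L₁ ; L₂)`. -/
def Code.MI (C : Code Ω V d) (L₁ L₂ : List Atom) : ℝ :=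
  C.HL L₁ + C.HL L₂ - C.HL (L₁ ++ L₂)

/-- Relabeling of an atom along a permutation of the storage-node indices. -/
def Atom.perm (π : Equiv.Perm ℕ) : Atom → Atom
  | .M i => .M i
  | .K => .K
  | .W i => .W (π i)
  | .S i j => .S (π i) (π j)

/-- A code is symmetrical if every joint entropy of a tuple of the basic random
variables is invariant under every permutation of the storage-node indices `[1:n]`. -/
def Code.Symmetrical (C : Code Ω V d) : Prop :=
  ∀ π : Equiv.Perm ℕ, (∀ i ∈ Finset.Icc 1 (d + 1), π i ∈ Finset.Icc 1 (d + 1)) →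
    ∀ L : List Atom, C.HL (L.map (Atom.perm π)) = C.HL L

/-- The list `[a, a+1, …, b]`. -/
def icc (a b : ℕ) : List ℕ := List.range' a (b + 1 - a)

/-- `W_A` as a list of atoms. -/
def Ws (A : List ℕ) : List Atom := A.map Atom.W

/-- `M_A` as a list of atoms. -/
def MsL (A : List ℕ) : List Atom := A.map Atom.M

/-- `M^{(m)} = (M_1, …, M_m)`. -/
def Mup (m : ℕ) : List Atom := MsL (icc 1 m)

/-- `S_{B → j}`. -/
def Sto (B : List ℕ) (j : ℕ) : List Atom := B.map fun i => Atom.S i j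

/-- `S_{i → B}`. -/
def Sfrom (i : ℕ) (B : List ℕ) : List Atom := B.map fun j => Atom.S i j

/-- `S̄_{→ j} = S_{[j+1:n] → j}` (here `n = d+1`). -/
def SbarTo (d j : ℕ) : List Atom := Sto (icc (j + 1) (d + 1)) j

/-- `S̄_{→ A}`. -/
def SbarToL (d : ℕ) (A : List ℕ) : List Atom := (A.map (SbarTo d)).flatten

/-- `S̲_{→ j} = S_{[1:j-1] → j}`. -/
def SunderTo (j : ℕ) : List Atom := Sto (icc 1 (j - 1)) j

/-- `S̲_{→ A}`. -/
def SunderToL (A : List ℕ) : List Atom := (A.map SunderTo).flatten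

/-- `S_{→ j} = S_{([1:n] ∖ {j}) → j}` (here `n = d+1`). -/
def StoFull (d j : ℕ) : List Atom := Sto ((icc 1 (d + 1)).filter (fun i => i ≠ j)) j

/-- `(S_{→ j} : j ∈ A)`. -/
def StoFullL (d : ℕ) (A : List ℕ) : List Atom := (A.map (StoFull d)).flatten

/-- `U^{(t,s)} = (W_{[1:t]}, S̄_{→[t+1:s]})`. -/
def U (d t s : ℕ) : List Atom := Ws (icc 1 t) ++ SbarToL d (icc (t + 1) s)

/-- Node regeneration: each `W j` is a deterministic function of `S_{→ j}`. -/
def Code.NodeRegen (C : Code Ω V d) : Prop :=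
  ∀ j ∈ Finset.Icc 1 (d + 1), IsFuncOf (C.W j) (C.rv (StoFull d j))

/-- Message recovery for parameter `ℓ`: `M j` is constant for `j ∈ [1:ℓ]`, and for every
`A ⊆ [1:n]` with `|A| ∈ [ℓ+1:d]`, `M_{|A|}` is a deterministic function of `W_A`. -/
def Code.MsgRecovery (C : Code Ω V d) (ℓ : ℕ) : Prop :=
  (∀ j ∈ Finset.Icc 1 ℓ, ∃ c : V, ∀ ω, C.M j ω = c) ∧
  ∀ A : Finset ℕ, A ⊆ Finset.Icc 1 (d + 1) → A.card ∈ Finset.Icc (ℓ + 1) d →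
    IsFuncOf (C.M A.card) (C.rv (Ws (A.sort (· ≤ ·))))

/-- Repair secrecy for parameters `ℓ₁, ℓ₂`: for all disjoint `E₁, E₂ ⊆ [1:n]` with
`|E₁| = ℓ₁`, `|E₂| = ℓ₂`, the messages `M_{ℓ+1}, …, M_d` are independent of
`((W_i : i ∈ E₁), (S_{→j} : j ∈ E₂))`, where `ℓ = ℓ₁ + ℓ₂`. -/
def Code.RepairSecrecy (C : Code Ω V d) (ℓ₁ ℓ₂ : ℕ) : Prop :=
  ∀ E₁ E₂ : Finset ℕ, E₁ ⊆ Finset.Icc 1 (d + 1) → E₂ ⊆ Finset.Icc 1 (d + 1) →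
    Disjoint E₁ E₂ → E₁.card = ℓ₁ → E₂.card = ℓ₂ →
    C.MI (MsL (icc (ℓ₁ + ℓ₂ + 1) d))
      (Ws (E₁.sort (· ≤ ·)) ++ StoFullL d (E₂.sort (· ≤ ·))) = 0

/-- `T_{d,k,ℓ} = Σ_{t=ℓ+1}^{k} (d+1−t)`, as a real number. -/
def T (d k ℓ : ℕ) : ℝ := ∑ t ∈ Finset.Icc (ℓ + 1) k, ((d : ℝ) + 1 - (t : ℝ))


theorem IsFuncOf.of_factorsThrough {Ω α β : Type*} [Nonempty α] {X : Ω → α} {Y : Ω → β}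
    (h : ∀ ω ω', Y ω = Y ω' → X ω = X ω') : IsFuncOf X Y := by
  obtain ⟨f, hf⟩ := (Function.factorsThrough_iff X).1 fun ω ω' => h ω ω'
  exact ⟨f, fun ω => congrFun hf ω⟩

theorem H_congr (p : Ω → ℝ) {α β : Type*} {X : Ω → α} {Y : Ω → β}
    (h : ∀ ω ω', X ω = X ω' ↔ Y ω = Y ω') : H p X = H p Y := by
  simp only [H, pm, h]

theorem sum_pm_mul (p : Ω → ℝ) {α : Type*} (X : Ω → α) (s : Finset α) (hs : ∀ ω, X ω ∈ s)
    (g : α → ℝ) : ∑ x ∈ s, pm p X x * g x = ∑ ω, p ω * g (X ω) := by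
  rw [← Finset.sum_fiberwise_of_maps_to (s := Finset.univ) (t := s) (g := X) fun ω _ => hs ω]
  refine Finset.sum_congr rfl fun x _ => ?_
  rw [pm, Finset.sum_mul]
  refine Finset.sum_congr (by ext; simp) fun ω hω => ?_
  rw [(Finset.mem_filter.1 hω).2]

theorem sum_pm_pair (p : Ω → ℝ) {α γ : Type*} (X : Ω → α) (Z : Ω → γ) (t : Finset γ)
    (ht : ∀ ω, Z ω ∈ t) (x : α) : ∑ z ∈ t, pm p (fun ω => (X ω, Z ω)) (x, z) = pm p X x := by
  simp only [pm, Prod.mk.injEq]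
  rw [← Finset.sum_fiberwise_of_maps_to (s := Finset.univ.filter fun ω => X ω = x) (t := t)
    (g := Z) fun ω _ => ht ω]
  refine Finset.sum_congr rfl fun z _ => Finset.sum_congr ?_ fun _ _ => rfl
  ext; simp

theorem pm_nonneg {p : Ω → ℝ} (hp : ∀ ω, 0 ≤ p ω) {α : Type*} (X : Ω → α) (x : α) :
    0 ≤ pm p X x := Finset.sum_nonneg fun ω _ => hp ω

theorem pm_self_pos {p : Ω → ℝ} (hp : ∀ ω, 0 ≤ p ω) {α : Type*} (X : Ω → α) {ω : Ω}
    (hω : 0 < p ω) : 0 < pm p X (X ω) :=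
  hω.trans_le <| Finset.single_le_sum (f := p) (fun ω _ => hp ω) (by simp)

/-- Conditioning on more data does not increase entropy: if `Y` is a function of `X`, then
`H(Z | X) ≤ H(Z | Y)`. -/
theorem H_pair_add_le {p : Ω → ℝ} (hp : ∀ ω, 0 ≤ p ω) (hp1 : ∑ ω, p ω = 1) {α β γ : Type*}
    {X : Ω → α} {Y : Ω → β} (Z : Ω → γ) (hXY : IsFuncOf Y X) :
    H p (fun ω => (X ω, Z ω)) + H p Y ≤ H p X + H p (fun ω => (Y ω, Z ω)) := by
  obtain ⟨f, hf⟩ := hXY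
  set XZ : Ω → α × γ := fun ω => (X ω, Z ω) with hXZ
  set YZ : Ω → β × γ := fun ω => (Y ω, Z ω) with hYZ
  let g : α × γ → ℝ := fun q =>
    pm p X q.1 * pm p YZ (f q.1, q.2) / (pm p XZ q * pm p Y (f q.1))
  have log_le (ω : Ω) : p ω * (Real.log (pm p X (X ω)) + Real.log (pm p YZ (YZ ω))
      - Real.log (pm p XZ (XZ ω)) - Real.log (pm p Y (Y ω))) ≤ p ω * g (XZ ω) - p ω := by
    rcases (hp ω).eq_or_lt with h0 | hpos
    · simp [← h0]
    have hX := pm_self_pos hp X hpos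
    have hY := pm_self_pos hp Y hpos
    have hXZ' := pm_self_pos hp XZ hpos
    have hYZ' := pm_self_pos hp YZ hpos
    have hg : g (XZ ω) = pm p X (X ω) * pm p YZ (YZ ω) / (pm p XZ (XZ ω) * pm p Y (Y ω)) := by
      simp only [g, hXZ, hYZ, hf]
    have hlog := Real.log_le_sub_one_of_pos (x := g (XZ ω)) (by rw [hg]; positivity)
    rw [hg, Real.log_div (by positivity) (by positivity), Real.log_mul hX.ne' hYZ'.ne',
      Real.log_mul hXZ'.ne' hY.ne', ← hg] at hlog
    nlinarith
  have sum_le : ∑ ω, p ω * g (XZ ω) ≤ 1 := by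
    let s := Finset.univ.image X
    let t := Finset.univ.image Z
    have hs (ω : Ω) : X ω ∈ s := Finset.mem_image_of_mem _ (Finset.mem_univ _)
    have ht (ω : Ω) : Z ω ∈ t := Finset.mem_image_of_mem _ (Finset.mem_univ _)
    rw [← sum_pm_mul p XZ (s ×ˢ t) (fun ω => Finset.mem_product.2 ⟨hs ω, ht ω⟩) g,
      Finset.sum_product]
    calc ∑ x ∈ s, ∑ z ∈ t, pm p XZ (x, z) * g (x, z)
        ≤ ∑ x ∈ s, ∑ z ∈ t, pm p YZ (f x, z) * (pm p X x / pm p Y (f x)) := by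
          refine Finset.sum_le_sum fun x _ => Finset.sum_le_sum fun z _ => ?_
          have h1 := pm_nonneg hp X x
          have h2 := pm_nonneg hp Y (f x)
          have h3 := pm_nonneg hp YZ (f x, z)
          rcases (pm_nonneg hp XZ (x, z)).eq_or_lt with h0 | hpos
          · rw [← h0, zero_mul]
            positivity
          · refine le_of_eq ?_
            simp only [g]
            rw [mul_comm (pm p XZ (x, z)) (pm p Y (f x)), ← div_div, mul_div_cancel₀ _ hpos.ne']
            ring
      _ ≤ ∑ x ∈ s, pm p X x * 1 := by
          refine Finset.sum_le_sum fun x _ => ?_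
          rw [← Finset.sum_mul, sum_pm_pair p Y Z t ht, mul_div_left_comm]
          exact mul_le_mul_of_nonneg_left (div_self_le_one _) (pm_nonneg hp X x)
      _ = 1 := by rw [sum_pm_mul p X s hs fun _ => 1]; simpa using hp1
  have key := Finset.sum_le_sum fun ω (_ : ω ∈ Finset.univ) => log_le ω
  simp only [mul_sub, mul_add, Finset.sum_sub_distrib, Finset.sum_add_distrib, hp1] at key
  simp only [H]
  linarith

/-- Conditioning on a larger list of basic random variables does not increase entropy. -/
theorem Code.HL_concat_add_le (C : Code Ω V d) {L L' : List Atom} (h : L' ⊆ L) (a : Atom) :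
    C.HL (L ++ [a]) + C.HL L' ≤ C.HL L + C.HL (L' ++ [a]) := by
  have hpair (L : List Atom) :
      C.HL (L ++ [a]) = H C.p fun ω => (C.rv L ω, C.atomRV a ω) :=
    H_congr C.p fun ω ω' => by
      simp only [Code.rv, List.map_inj_left, Prod.mk.injEq, List.mem_append, List.mem_singleton]
      grind
  have hfun : IsFuncOf (C.rv L') (C.rv L) := .of_factorsThrough fun ω ω' hω => by
    simp only [Code.rv, List.map_inj_left] at hω ⊢
    exact fun b hb => hω b (h hb)
  rw [hpair, hpair]
  exact H_pair_add_le C.p_nonneg C.p_sum _ hfun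

theorem icc_concat {a b : ℕ} (h : a ≤ b + 1) : icc a (b + 1) = icc a b ++ [b + 1] := by
  simp only [icc]
  rw [show b + 1 + 1 - a = (b + 1 - a) + 1 by omega, List.range'_concat]
  congr 2
  omega

theorem mem_icc {a b i : ℕ} : i ∈ icc a b ↔ a ≤ i ∧ i ≤ b := by
  simp only [icc, List.mem_range'_1]
  omega

/-- An injection of a subset of `t` into `t` extends to a permutation preserving `t`. -/
theorem exists_perm_extending {α : Type*} {s t : Finset α} (hs : s ⊆ t) {f : α → α}
    (hf : ∀ i ∈ s, f i ∈ t) (hinj : Set.InjOn f s) :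
    ∃ π : Equiv.Perm α, (∀ i ∈ t, π i ∈ t) ∧ ∀ i ∈ s, π i = f i := by
  obtain ⟨g, hg⟩ := Finset.exists_equiv_extend_of_card_eq (α := t) (t := t) (by simp)
    (s := s.subtype (· ∈ t)) (f := fun i => f i)
    (by
      intro y hy
      obtain ⟨x, hx, rfl⟩ := Finset.mem_image.1 hy
      exact hf _ (Finset.mem_subtype.1 hx))
    (fun x hx y hy hxy => Subtype.ext <|
      hinj (Finset.mem_subtype.1 hx) (Finset.mem_subtype.1 hy) hxy)
  refine ⟨Equiv.Perm.ofSubtype g, fun i hi => ?_, fun i hi => ?_⟩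
  · rw [Equiv.Perm.ofSubtype_apply_of_mem g hi]
    exact (g ⟨i, hi⟩).2
  · rw [Equiv.Perm.ofSubtype_apply_of_mem g (hs hi)]
    exact hg ⟨i, hs hi⟩ (Finset.mem_subtype.2 hi)

/-- In a symmetrical code the entropy of `S_{i → A}` only depends on the number of targets:
relabeling `i` and `A` injectively does not change it. -/
theorem Code.Symmetrical.HL_Sfrom_map {C : Code Ω V d} (hsym : C.Symmetrical) {i : ℕ}
    {A : List ℕ} {f : ℕ → ℕ} (hA : ∀ j ∈ i :: A, j ∈ Finset.Icc 1 (d + 1))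
    (hf : ∀ j ∈ i :: A, f j ∈ Finset.Icc 1 (d + 1))
    (hinj : Set.InjOn f {j | j ∈ i :: A}) :
    C.HL (Sfrom (f i) (A.map f)) = C.HL (Sfrom i A) := by
  obtain ⟨π, hπ, hπf⟩ := exists_perm_extending (s := (i :: A).toFinset) (t := Finset.Icc 1 (d + 1))
    (fun j hj => hA j (List.mem_toFinset.1 hj)) (fun j hj => hf j (List.mem_toFinset.1 hj))
    (fun x hx y hy hxy => hinj (List.mem_toFinset.1 hx) (List.mem_toFinset.1 hy) hxy)
  rw [← hsym π hπ (Sfrom i A)]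
  congr 1
  simp only [Sfrom, List.map_map, List.map_inj_left, Function.comp_apply, Atom.perm]
  intro j hj
  rw [hπf i (by simp), hπf j (by simp [hj])]

theorem statement16 {Ω V : Type} [Fintype Ω] {d : ℕ} (hd : 2 ≤ d)
    {ℓ₁ ℓ₂ ℓ : ℕ} (hℓdef : ℓ = ℓ₁ + ℓ₂) (hℓd : ℓ < d) (hℓ12 : ℓ₁ ≤ ℓ₂)
    (C : Code Ω V d) (hsym : C.Symmetrical) (hregen : C.NodeRegen)
    {m k : ℕ} (hm : m ∈ Finset.Icc 1 ℓ₁) (hk : k ∈ Finset.Icc (ℓ + 1) d) :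
    C.HL (Sfrom (ℓ₁ + 1) (icc 1 m)) + C.HL (U d ℓ₁ ℓ ++ Sto (icc (ℓ + 2) k) (ℓ + 1))
      ≥ C.HL (Sfrom (ℓ₁ + 1) (icc 1 (m - 1)))
        + C.HL (U d ℓ₁ ℓ ++ Sto (icc (ℓ + 2) (k + 1)) (ℓ + 1)) := by
  rw [Finset.mem_Icc] at hm hk
  obtain ⟨m, rfl⟩ : ∃ m', m = m' + 1 := ⟨m - 1, by omega⟩
  let f : ℕ → ℕ := fun i => if i ≤ m then ℓ₁ + i else if i = m + 1 then ℓ + 1 else k + 1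
  have hfcenter : f (ℓ₁ + 1) = k + 1 := by grind
  have hflast : f (m + 1) = ℓ + 1 := by grind
  have hmap : (icc 1 (m + 1)).map f = (icc 1 m).map f ++ [ℓ + 1] := by
    rw [icc_concat (by omega), List.map_append, List.map_singleton, hflast]
  have hsymm (r : ℕ) (hr : r ≤ m + 1) :
      C.HL (Sfrom (k + 1) ((icc 1 r).map f)) = C.HL (Sfrom (ℓ₁ + 1) (icc 1 r)) := by
    rw [← hfcenter]
    refine hsym.HL_Sfrom_map (fun j hj => ?_) (fun j hj => ?_) fun i hi j hj hij => ?_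
    · simp only [List.mem_cons, mem_icc] at hj
      rw [Finset.mem_Icc]
      omega
    · simp only [List.mem_cons, mem_icc] at hj
      rw [Finset.mem_Icc]
      grind
    · simp only [List.mem_cons, mem_icc, Set.mem_ofPred_eq] at hi hj
      grind
  have hsub : Sfrom (k + 1) ((icc 1 m).map f) ⊆ U d ℓ₁ ℓ ++ Sto (icc (ℓ + 2) k) (ℓ + 1) := by
    intro a ha
    simp only [Sfrom, List.mem_map, mem_icc] at ha
    obtain ⟨_, ⟨i, hi, rfl⟩, rfl⟩ := ha
    have hfi : f i = ℓ₁ + i := if_pos hi.2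
    refine List.mem_append_left _ (List.mem_append_right _ ?_)
    simp only [SbarToL, SbarTo, Sto, List.mem_flatten, List.mem_map, mem_icc]
    refine ⟨_, ⟨ℓ₁ + i, by omega, rfl⟩, ?_⟩
    simp only [List.mem_map, mem_icc]
    exact ⟨k + 1, by omega, by rw [hfi]⟩
  have key := C.HL_concat_add_le hsub (Atom.S (k + 1) (ℓ + 1))
  have hto : U d ℓ₁ ℓ ++ Sto (icc (ℓ + 2) (k + 1)) (ℓ + 1)
      = U d ℓ₁ ℓ ++ Sto (icc (ℓ + 2) k) (ℓ + 1) ++ [Atom.S (k + 1) (ℓ + 1)] := by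
    rw [icc_concat (by omega)]
    simp [Sto]
  have hfrom : Sfrom (k + 1) ((icc 1 m).map f) ++ [Atom.S (k + 1) (ℓ + 1)]
      = Sfrom (k + 1) ((icc 1 (m + 1)).map f) := by
    rw [hmap]
    simp [Sfrom]
  rw [hfrom, ← hto, hsymm m (by omega), hsymm (m + 1) le_rfl] at key
  rw [Nat.add_sub_cancel]
  linarith

end

end MDCSR
end

section
/- (Properties of the index sets τ_q) Let d ≥ 2, ℓ ∈ [1:d−1], ℓ₁ ∈ [0:⌊ℓ/2⌋], and write d−ℓ₁ = s(d−ℓ) + r with integers s ≥ 1 and r ∈ [1:d−ℓ]. Then: (i) τ_q ∩ τ_{q'} = ∅ for all q ≠ q' in [0:s]; (ii) ∪_{q=0}^{s−1} τ_q = [1:ℓ₁] ∪ [2ℓ₁+1:ℓ]; and (iii) τ_s = [ℓ+2:d+1]. -/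
open scoped BigOperators Classical

namespace MDCSR

noncomputable section

variable {Ω V : Type} [Fintype Ω]

variable {d : ℕ}

/-- The relabeling `a_t` from the appendix. -/
def aIdx (ℓ ℓ₁ t : ℕ) : ℕ :=
  if t ≤ ℓ₁ then t else if t ≤ ℓ - ℓ₁ then t + ℓ₁ else t + ℓ₁ + 1

/-- The index set `τ_q` from the appendix, as a finset. -/
def tauF (d ℓ ℓ₁ r q : ℕ) : Finset ℕ :=
  if q = 0 then (Finset.Icc 1 r).image (aIdx ℓ ℓ₁)
  else (Finset.Icc (r + 1 + (q - 1) * (d - ℓ)) (r + q * (d - ℓ))).image (aIdx ℓ ℓ₁)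

/-- `a_t` is strictly increasing in `t`. -/
lemma strictMono_aIdx (ℓ ℓ₁ : ℕ) : StrictMono (aIdx ℓ ℓ₁) := by
  intro t t' h
  unfold aIdx
  split_ifs <;> omega

/-- For `r ≤ d - ℓ` the index blocks of all the `τ_q`, including `q = 0`, have a uniform
description. -/
lemma mem_tauF {d ℓ ℓ₁ r q x : ℕ} (hr : r ≤ d - ℓ) :
    x ∈ tauF d ℓ ℓ₁ r q ↔ ∃ t, 1 ≤ t ∧ r + q * (d - ℓ) < t + (d - ℓ) ∧
      t ≤ r + q * (d - ℓ) ∧ aIdx ℓ ℓ₁ t = x := by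
  unfold tauF
  rcases q with _ | q
  · simp only [if_true, Finset.mem_image, Finset.mem_Icc, zero_mul, add_zero]
    refine exists_congr fun t => ?_
    constructor
    · rintro ⟨⟨h₁, h₂⟩, h₃⟩
      exact ⟨h₁, by omega, h₂, h₃⟩
    · rintro ⟨h₁, -, h₂, h₃⟩
      exact ⟨⟨h₁, h₂⟩, h₃⟩
  · simp only [Nat.succ_ne_zero, if_false, Finset.mem_image, Finset.mem_Icc,
      Nat.add_sub_cancel, Nat.succ_mul]
    refine exists_congr fun t => ?_
    constructor
    · rintro ⟨⟨h₁, h₂⟩, h₃⟩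
      exact ⟨by omega, by omega, h₂, h₃⟩
    · rintro ⟨h₁, h₂, h₃, h₄⟩
      exact ⟨⟨by omega, h₃⟩, h₄⟩

/-- The index sets `τ_q` are pairwise disjoint. -/
lemma disjoint_tauF_of_lt {d ℓ ℓ₁ r q q' : ℕ} (hr : r ≤ d - ℓ) (h : q < q') :
    Disjoint (tauF d ℓ ℓ₁ r q) (tauF d ℓ ℓ₁ r q') := by
  rw [Finset.disjoint_left]
  intro x hx hx'
  obtain ⟨t, -, -, h₁, rfl⟩ := (mem_tauF hr).1 hx
  obtain ⟨t', -, h₂, -, h₃⟩ := (mem_tauF hr).1 hx'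
  obtain rfl := (strictMono_aIdx ℓ ℓ₁).injective h₃
  have hmul := Nat.mul_le_mul_right (d - ℓ) (Nat.succ_le_of_lt h)
  rw [Nat.succ_mul] at hmul
  omega

theorem statement19 {d ℓ ℓ₁ s r : ℕ} (hd : 2 ≤ d) (hℓ : ℓ ∈ Finset.Icc 1 (d - 1))
    (hℓ₁ : ℓ₁ ∈ Finset.Icc 0 (ℓ / 2)) (hs : 1 ≤ s) (hr : r ∈ Finset.Icc 1 (d - ℓ))
    (hsr : d - ℓ₁ = s * (d - ℓ) + r) :
    (∀ q ∈ Finset.Icc 0 s, ∀ q' ∈ Finset.Icc 0 s, q ≠ q' →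
        Disjoint (tauF d ℓ ℓ₁ r q) (tauF d ℓ ℓ₁ r q')) ∧
      (Finset.range s).biUnion (tauF d ℓ ℓ₁ r)
          = Finset.Icc 1 ℓ₁ ∪ Finset.Icc (2 * ℓ₁ + 1) ℓ ∧
      tauF d ℓ ℓ₁ r s = Finset.Icc (ℓ + 2) (d + 1) := by
  simp only [Finset.mem_Icc] at hℓ hℓ₁ hr
  have hm : 0 < d - ℓ := by omega
  refine ⟨fun q _ q' _ hne => ?_, ?_, ?_⟩
  · rcases lt_or_gt_of_ne hne with h | h
    · exact disjoint_tauF_of_lt hr.2 h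
    · exact (disjoint_tauF_of_lt hr.2 h).symm
  · ext x
    simp only [Finset.mem_biUnion, Finset.mem_range, mem_tauF hr.2, Finset.mem_union,
      Finset.mem_Icc]
    constructor
    · rintro ⟨q, hq, t, h₁, -, h₂, rfl⟩
      have hmul := Nat.mul_le_mul_right (d - ℓ) (Nat.succ_le_of_lt hq)
      rw [Nat.succ_mul] at hmul
      unfold aIdx
      split_ifs <;> omega
    · intro hx
      obtain ⟨t, h₁, h₂, rfl⟩ : ∃ t, 1 ≤ t ∧ t ≤ ℓ - ℓ₁ ∧ aIdx ℓ ℓ₁ t = x := by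
        rcases hx with hx | hx
        · exact ⟨x, hx.1, by omega, if_pos hx.2⟩
        · refine ⟨x - ℓ₁, by omega, by omega, ?_⟩
          unfold aIdx
          split_ifs <;> omega
      have hlow := Nat.div_mul_le_self (t + (d - ℓ) - r - 1) (d - ℓ)
      have hupp := Nat.lt_div_mul_add hm (a := t + (d - ℓ) - r - 1)
      refine ⟨(t + (d - ℓ) - r - 1) / (d - ℓ), ?_, t, h₁, by omega, by omega, rfl⟩
      rw [Nat.div_lt_iff_lt_mul hm]
      omega
  · ext x
    rw [mem_tauF hr.2, Finset.mem_Icc]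
    constructor
    · rintro ⟨t, h₁, h₂, h₃, rfl⟩
      unfold aIdx
      split_ifs <;> omega
    · intro hx
      refine ⟨x - ℓ₁ - 1, by omega, by omega, by omega, ?_⟩
      unfold aIdx
      split_ifs <;> omega

end

end MDCSR
end
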